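/- arXiv:2102.13182 — 2 statements merged into one kernel-verified Lean document; each statement's English description precedes it below -/
import Mathlib

section
/- Let z = (z_1, …, z_d) be a random vector in ℝ^d with a joint pdf and continuous marginal cdfs, and let u_z be its copula-uniform dual representation. If the differential entropies h(z), h(u_z) and h(z_i) for i = 1, …, d all exist and are finite, then h(z) = h(u_z) + Σ_{i=1}^d h(z_i). -/
open MeasureTheory Real Set Filter

noncomputable section
open scoped Classical

/-- The unit cube `[0,1]^d`. -/
def Cube (d : ℕ) : Set (Fin d → ℝ) := Set.univ.pi fun _ => Set.Icc (0:ℝ) 1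

/-- The uniform distribution on `[0,1]`. -/
def unif01 : Measure ℝ := volume.restrict (Set.Icc (0:ℝ) 1)

/-- A copula distribution on `[0,1]^d`: a probability measure supported on the cube,
absolutely continuous w.r.t. Lebesgue measure, with uniform one-dimensional marginals. -/
structure IsCopula {d : ℕ} (P : Measure (Fin d → ℝ)) : Prop where
  prob : IsProbabilityMeasure P
  ac : P ≪ volume
  mass : P (Cube d) = 1
  marg : ∀ i : Fin d, P.map (fun u => u i) = unif01

/-- Lebesgue density of a measure. -/
def dens {α : Type*} [MeasureSpace α] (P : Measure α) : α → ℝ :=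
  fun x => (P.rnDeriv volume x).toReal

/-- Differential entropy `-∫ p log p` (w.r.t. Lebesgue measure). -/
def diffEnt {α : Type*} [MeasureSpace α] (P : Measure α) : ℝ :=
  - ∫ x, dens P x * Real.log (dens P x)

/-- The differential entropy of `P` exists and is finite. -/
def FiniteEnt {α : Type*} [MeasureSpace α] (P : Measure α) : Prop :=
  Integrable (fun x => dens P x * Real.log (dens P x))

/-- Tonelli's theorem for a product of functions of separate coordinates. -/
theorem lintegral_fin_prod_eq_prod {n : ℕ} (f : Fin n → ℝ → ENNReal)
    (hf : ∀ i, Measurable (f i)) :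
    ∫⁻ x : Fin n → ℝ, ∏ i, f i (x i) = ∏ i, ∫⁻ t, f i t := by
  induction n with
  | zero => simp [volume_pi]
  | succ n ih =>
    have e := (volume_preserving_piFinSuccAbove (fun _ : Fin (n + 1) => ℝ) 0).symm
    rw [← e.lintegral_comp_emb (MeasurableEquiv.measurableEmbedding _)]
    simp only [Fin.prod_univ_succ]
    have h := lintegral_prod_mul (μ := (volume : Measure ℝ))
      (ν := (volume : Measure (Fin n → ℝ))) (f := f 0)
      (g := fun y => ∏ i : Fin n, f i.succ (y i)) (hf 0).aemeasurable
      (Finset.measurable_fun_prod _ fun i _ =>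
        (hf i.succ).comp (measurable_pi_apply i)).aemeasurable
    rw [ih _ fun i => hf i.succ] at h
    rw [← h]
    rfl

theorem pi_eq_withDensity_prod_rnDeriv {d : ℕ} (ν : Fin d → Measure ℝ)
    [∀ i, SigmaFinite (ν i)] (hν : ∀ i, ν i ≪ volume) :
    Measure.pi ν = volume.withDensity fun x => ∏ i, (ν i).rnDeriv volume (x i) := by
  refine Measure.pi_eq fun s hs => ?_
  rw [withDensity_apply _ (MeasurableSet.univ_pi hs),
    ← lintegral_indicator (MeasurableSet.univ_pi hs)]
  have h : ∀ x : Fin d → ℝ,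
      (univ.pi s).indicator (fun x => ∏ i, (ν i).rnDeriv volume (x i)) x
        = ∏ i, (s i).indicator ((ν i).rnDeriv volume) (x i) := by
    intro x
    by_cases hx : x ∈ univ.pi s
    · rw [indicator_of_mem hx]
      exact Finset.prod_congr rfl fun i _ => (indicator_of_mem (hx i trivial) _).symm
    · rw [indicator_of_notMem hx]
      simp only [mem_univ_pi, not_forall] at hx
      obtain ⟨i, hi⟩ := hx
      exact (Finset.prod_eq_zero (Finset.mem_univ i) (indicator_of_notMem hi _)).symm
  simp_rw [h]
  rw [lintegral_fin_prod_eq_prod _ fun i => (Measure.measurable_rnDeriv _ _).indicator (hs i)]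
  refine Finset.prod_congr rfl fun i _ => ?_
  rw [lintegral_indicator (hs i), Measure.setLIntegral_rnDeriv (hν i)]

theorem map_withDensity_comp {α β : Type*} [MeasurableSpace α] [MeasurableSpace β]
    (Q : Measure α) {T : α → β} (hT : Measurable T) {c : β → ENNReal} (hc : Measurable c) :
    (Q.withDensity (c ∘ T)).map T = (Q.map T).withDensity c := by
  ext s hs
  rw [Measure.map_apply hT hs, withDensity_apply _ (hT hs), withDensity_apply _ hs,
    setLIntegral_map hs hc hT]
  rfl

/-- The probability integral transform. -/
theorem map_eq_unif01_of_continuous_cdf (ν : Measure ℝ) [IsProbabilityMeasure ν] {G : ℝ → ℝ}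
    (hG : ∀ t, G t = (ν (Iic t)).toReal) (hGc : Continuous G) : ν.map G = unif01 := by
  have hcdf : G = ProbabilityTheory.cdf ν := by
    ext t; rw [hG, ProbabilityTheory.cdf_eq_real]; rfl
  have hbot : Tendsto G atBot (nhds 0) := hcdf ▸ ProbabilityTheory.tendsto_cdf_atBot ν
  have htop : Tendsto G atTop (nhds 1) := hcdf ▸ ProbabilityTheory.tendsto_cdf_atTop ν
  have hmono : Monotone G := hcdf ▸ ProbabilityTheory.monotone_cdf ν
  have h0 : ∀ t, 0 ≤ G t := fun t => hcdf ▸ ProbabilityTheory.cdf_nonneg ν t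
  have h1 : ∀ t, G t ≤ 1 := fun t => hcdf ▸ ProbabilityTheory.cdf_le_one ν t
  have := Measure.isProbabilityMeasure_map (μ := ν) hGc.aemeasurable
  refine Measure.ext_of_Iic _ _ fun t => ?_
  rw [Measure.map_apply hGc.measurable measurableSet_Iic, unif01,
    Measure.restrict_apply measurableSet_Iic]
  rcases lt_or_ge t 0 with ht0 | ht0
  · have e1 : G ⁻¹' Iic t = ∅ := by
      ext x; simpa using ht0.trans_le (h0 x)
    have e2 : Iic t ∩ Icc (0 : ℝ) 1 = ∅ := by
      ext x; simp only [mem_inter_iff, mem_Iic, mem_Icc, mem_empty_iff_false]; grind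
    simp [e1, e2]
  rcases le_or_gt 1 t with ht1 | ht1
  · have e1 : G ⁻¹' Iic t = univ := by
      ext x; simpa using (h1 x).trans ht1
    have e2 : Iic t ∩ Icc (0 : ℝ) 1 = Icc 0 1 := by
      ext x; simp only [mem_inter_iff, mem_Iic, mem_Icc]; grind
    simp [e1, e2]
  have e2 : Iic t ∩ Icc (0 : ℝ) 1 = Icc 0 t := by
    ext x; simp only [mem_inter_iff, mem_Iic, mem_Icc]; grind
  rw [e2, Real.volume_Icc, sub_zero]
  obtain ⟨b, hb⟩ : ∃ b, t < G b := (htop.eventually (lt_mem_nhds ht1)).exists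
  rcases (G ⁻¹' Iic t).eq_empty_or_nonempty with hS | hS
  · have : t ≤ 0 := ge_of_tendsto' hbot fun x => by
      by_contra! hx
      exact hS.subset (show x ∈ G ⁻¹' Iic t from hx.le)
    rw [hS, measure_empty, ENNReal.ofReal_of_nonpos this]
  · have hbdd : BddAbove (G ⁻¹' Iic t) :=
      ⟨b, fun x hx => by
        by_contra! h
        exact absurd (hmono h.le) (not_le.2 (lt_of_le_of_lt hx hb))⟩
    have ha : sSup (G ⁻¹' Iic t) ∈ G ⁻¹' Iic t :=
      (isClosed_Iic.preimage hGc).csSup_mem hS hbdd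
    set a := sSup (G ⁻¹' Iic t)
    have hab : a ≤ b := by
      by_contra! h
      exact absurd (hmono h.le) (not_le.2 (lt_of_le_of_lt ha hb))
    obtain ⟨x, -, hx⟩ := intermediate_value_Icc hab hGc.continuousOn ⟨ha, hb.le⟩
    have hat : G a = t := le_antisymm ha (hx ▸ hmono (le_csSup hbdd hx.le))
    have e1 : G ⁻¹' Iic t = Iic a :=
      Subset.antisymm (fun y hy => le_csSup hbdd hy) fun y hy => (hmono hy).trans ha
    rw [e1, ← hat, hG, ENNReal.ofReal_toReal (measure_ne_top _ _)]

/-- Sublevel sets of a continuous cdf agree almost everywhere with half-lines. -/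
theorem Iic_ae_eq_preimage_Iic_cdf (ν : Measure ℝ) [IsProbabilityMeasure ν] {G : ℝ → ℝ}
    (hG : ∀ t, G t = (ν (Iic t)).toReal) (hGc : Continuous G) (a : ℝ) :
    Iic a =ᵐ[ν] G ⁻¹' Iic (G a) := by
  have hmono : Monotone G := fun x y h => by
    rw [hG, hG]
    exact ENNReal.toReal_mono (measure_ne_top _ _) (measure_mono (Iic_subset_Iic.2 h))
  refine ae_eq_of_subset_of_measure_ge (fun x hx => hmono hx) ?_
    measurableSet_Iic.nullMeasurableSet (measure_ne_top _ _)
  have h1 : G a ≤ 1 := by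
    rw [hG]; exact ENNReal.toReal_mono ENNReal.one_ne_top prob_le_one
  have h0 : 0 ≤ G a := by rw [hG]; exact ENNReal.toReal_nonneg
  have e2 : Iic (G a) ∩ Icc (0 : ℝ) 1 = Icc 0 (G a) := by
    ext x; simp only [mem_inter_iff, mem_Iic, mem_Icc]; grind
  rw [← Measure.map_apply hGc.measurable measurableSet_Iic,
    map_eq_unif01_of_continuous_cdf ν hG hGc, unif01, Measure.restrict_apply measurableSet_Iic,
    e2, Real.volume_Icc, sub_zero, hG, ENNReal.ofReal_toReal (measure_ne_top _ _)]

/-- Finite measures on `ℝ^d` agreeing on all lower orthants are equal. -/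
theorem ext_of_pi_Iic {d : ℕ} (P P' : Measure (Fin d → ℝ)) [IsFiniteMeasure P]
    (huniv : P univ = P' univ)
    (h : ∀ a : Fin d → ℝ, P (univ.pi fun i => Iic (a i)) = P' (univ.pi fun i => Iic (a i))) :
    P = P' := by
  have hspan : IsCountablySpanning (range (Iic : ℝ → Set ℝ)) := by
    refine ⟨fun n : ℕ => Iic (n : ℝ), fun n => mem_range_self _, ?_⟩
    ext x
    simpa using exists_nat_ge x
  refine ext_of_generate_finite _
    (generateFrom_eq_pi (C := fun _ : Fin d => range (Iic : ℝ → Set ℝ))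
      (fun _ => (borel_eq_generateFrom_Iic ℝ).symm.trans (BorelSpace.measurable_eq).symm)
      fun _ => hspan).symm
    (IsPiSystem.pi fun _ => isPiSystem_Iic) ?_ huniv
  rintro _ ⟨s, hs, rfl⟩
  choose a ha using fun i => hs i trivial
  have : s = fun i => Iic (a i) := funext fun i => (ha i).symm
  rw [this]
  exact h a

section Copula

variable {d : ℕ} (P : Measure (Fin d → ℝ))

theorem map_eval_absolutelyContinuous (hP : P ≪ volume) (i : Fin d) :
    P.map (fun v => v i) ≪ volume :=
  (hP.map (measurable_pi_apply i)).trans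
    (Measure.quasiMeasurePreserving_eval (fun _ : Fin d => (volume : Measure ℝ))
      i).absolutelyContinuous

theorem absolutelyContinuous_pi_map_eval [IsProbabilityMeasure P] (hP : P ≪ volume) :
    P ≪ Measure.pi fun i => P.map (fun v : Fin d → ℝ => v i) := by
  have (i : Fin d) : IsProbabilityMeasure (P.map (fun v : Fin d → ℝ => v i)) :=
    Measure.isProbabilityMeasure_map (measurable_pi_apply i).aemeasurable
  rw [pi_eq_withDensity_prod_rnDeriv _ (map_eval_absolutelyContinuous P hP)]
  have hpos : ∀ᵐ x ∂P, ∏ i, (P.map (fun v : Fin d → ℝ => v i)).rnDeriv volume (x i) ≠ 0 := by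
    have := ae_all_iff.2 fun i => ae_of_ae_map (measurable_pi_apply i).aemeasurable
      (Measure.rnDeriv_pos (map_eval_absolutelyContinuous P hP i))
    filter_upwards [this] with x hx
    exact Finset.prod_ne_zero_iff.2 fun i _ => (hx i).ne'
  have hmeas : Measurable fun x : Fin d → ℝ =>
      ∏ i, (P.map (fun v : Fin d → ℝ => v i)).rnDeriv volume (x i) :=
    Finset.measurable_fun_prod _ fun i _ =>
      (Measure.measurable_rnDeriv _ _).comp (measurable_pi_apply i)
  refine Measure.AbsolutelyContinuous.mk fun s hs h => ?_
  rw [withDensity_apply_eq_zero hmeas] at h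
  rw [← measure_inter_add_sdiff s (hmeas (measurableSet_singleton 0)).compl]
  refine add_eq_zero.2 ⟨hP (by rwa [inter_comm] at h), ?_⟩
  exact measure_mono_null (fun x hx => by simpa using hx.2) hpos

variable {G : Fin d → ℝ → ℝ}

/-- Componentwise application of the marginal cdfs sends the product of the marginals to the
uniform distribution on the cube. -/
theorem map_pi_map_eval [IsProbabilityMeasure P]
    (hG : ∀ i t, G i t = (P.map (fun v => v i) (Iic t)).toReal) (hGc : ∀ i, Continuous (G i)) :
    (Measure.pi fun i => P.map (fun v : Fin d → ℝ => v i)).map (fun v i => G i (v i))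
      = volume.restrict (Cube d) := by
  have (i : Fin d) : IsProbabilityMeasure (P.map (fun v : Fin d → ℝ => v i)) :=
    Measure.isProbabilityMeasure_map (measurable_pi_apply i).aemeasurable
  have e (i : Fin d) := map_eq_unif01_of_continuous_cdf _ (hG i) (hGc i)
  have (i : Fin d) : SigmaFinite ((P.map (fun v : Fin d → ℝ => v i)).map (G i)) := by
    rw [e, unif01]; infer_instance
  rw [Measure.pi_map_pi fun i => (hGc i).aemeasurable]
  simp_rw [e, unif01]
  rw [← Measure.restrict_pi_pi]
  rfl

theorem copula_absolutelyContinuous [IsProbabilityMeasure P] (hP : P ≪ volume)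
    (hG : ∀ i t, G i t = (P.map (fun v => v i) (Iic t)).toReal) (hGc : ∀ i, Continuous (G i)) :
    P.map (fun v i => G i (v i)) ≪ volume.restrict (Cube d) := by
  rw [← map_pi_map_eval P hG hGc]
  exact (absolutelyContinuous_pi_map_eval P hP).map (by fun_prop)

/-- Sklar's theorem for densities, relative to the product of the marginals. -/
theorem eq_pi_withDensity_copula [IsProbabilityMeasure P] (hP : P ≪ volume)
    (hG : ∀ i t, G i t = (P.map (fun v => v i) (Iic t)).toReal) (hGc : ∀ i, Continuous (G i)) :
    P = (Measure.pi fun i => P.map (fun v : Fin d → ℝ => v i)).withDensity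
      ((P.map (fun v i => G i (v i))).rnDeriv volume ∘ fun v i => G i (v i)) := by
  have (i : Fin d) : IsProbabilityMeasure (P.map (fun v : Fin d → ℝ => v i)) :=
    Measure.isProbabilityMeasure_map (measurable_pi_apply i).aemeasurable
  set T : (Fin d → ℝ) → Fin d → ℝ := fun v i => G i (v i)
  set Q := Measure.pi fun i => P.map (fun v : Fin d → ℝ => v i) with hQ
  have hT : Measurable T := by fun_prop
  have hPQ : P ≪ Q := absolutelyContinuous_pi_map_eval P hP
  have hUL : P.map T ≪ volume.restrict (Cube d) := copula_absolutelyContinuous P hP hG hGc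
  have hcube : MeasurableSet (Cube d) := MeasurableSet.univ_pi fun _ => measurableSet_Icc
  have hU : (volume.restrict (Cube d)).withDensity ((P.map T).rnDeriv volume) = P.map T := by
    rw [← restrict_withDensity hcube, Measure.withDensity_rnDeriv_eq _ _
      (hUL.trans Measure.restrict_le_self.absolutelyContinuous)]
    exact Measure.restrict_eq_self_of_ae_mem (hUL.ae_le (ae_restrict_mem hcube))
  have hmap : (Q.withDensity ((P.map T).rnDeriv volume ∘ T)).map T = P.map T := by
    rw [map_withDensity_comp _ hT (Measure.measurable_rnDeriv _ _), hQ,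
      map_pi_map_eval P hG hGc, hU]
  refine ext_of_pi_Iic _ _ ?_ fun a => ?_
  · have := congrArg (fun m => m univ) hmap
    simpa [Measure.map_apply hT MeasurableSet.univ] using this.symm
  · have hae : (univ.pi fun i => Iic (a i)) =ᵐ[Q] T ⁻¹' (univ.pi fun i => Iic (G i (a i))) :=
      Measure.ae_eq_set_pi fun i _ => Iic_ae_eq_preimage_Iic_cdf _ (hG i) (hGc i) (a i)
    have hm : MeasurableSet (univ.pi fun i => Iic (G i (a i))) :=
      MeasurableSet.univ_pi fun _ => measurableSet_Iic
    rw [measure_congr (hPQ.ae_le hae),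
      measure_congr ((withDensity_absolutelyContinuous Q _).ae_le hae),
      ← Measure.map_apply hT hm, ← Measure.map_apply hT hm, hmap]

/-- Sklar's theorem for densities: the joint density is the copula density times the product of
the marginal densities. -/
theorem dens_ae_eq_copula_mul_prod [IsProbabilityMeasure P] (hP : P ≪ volume)
    (hG : ∀ i t, G i t = (P.map (fun v => v i) (Iic t)).toReal) (hGc : ∀ i, Continuous (G i)) :
    dens P =ᵐ[volume] fun x => dens (P.map (fun v i => G i (v i))) (fun i => G i (x i))
      * ∏ i, dens (P.map (fun v : Fin d → ℝ => v i)) (x i) := by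
  have (i : Fin d) : IsProbabilityMeasure (P.map (fun v : Fin d → ℝ => v i)) :=
    Measure.isProbabilityMeasure_map (measurable_pi_apply i).aemeasurable
  have hc : Measurable ((P.map (fun v i => G i (v i))).rnDeriv volume ∘
      fun (v : Fin d → ℝ) i => G i (v i)) :=
    (Measure.measurable_rnDeriv _ _).comp (by fun_prop)
  have hp : Measurable fun x : Fin d → ℝ =>
      ∏ i, (P.map (fun v : Fin d → ℝ => v i)).rnDeriv volume (x i) :=
    Finset.measurable_fun_prod _ fun i _ =>
      (Measure.measurable_rnDeriv _ _).comp (measurable_pi_apply i)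
  have h := eq_pi_withDensity_copula P hP hG hGc
  rw [pi_eq_withDensity_prod_rnDeriv _ (map_eval_absolutelyContinuous P hP),
    ← withDensity_mul _ hp hc] at h
  have h' := Measure.rnDeriv_withDensity volume (hp.mul hc)
  rw [← h] at h'
  filter_upwards [h'] with x hx
  simp only [dens, hx, Pi.mul_apply, ENNReal.toReal_mul, ENNReal.toReal_prod, Function.comp_apply]
  rw [mul_comm]

end Copula

theorem diffEnt_eq_neg_integral_log {α : Type*} [MeasureSpace α]
    [SigmaFinite (volume : Measure α)] {P : Measure α} [SigmaFinite P] (hP : P ≪ volume) :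
    diffEnt P = -∫ x, Real.log (dens P x) ∂P := by
  rw [diffEnt, ← integral_rnDeriv_smul hP]
  rfl

theorem FiniteEnt.integrable_log {α : Type*} [MeasureSpace α]
    [SigmaFinite (volume : Measure α)] {P : Measure α} [SigmaFinite P] (hP : P ≪ volume)
    (h : FiniteEnt P) : Integrable (fun x => Real.log (dens P x)) P :=
  (integrable_rnDeriv_smul_iff hP).1 h

theorem dens_ae_ne_zero {α : Type*} [MeasureSpace α]
    [SigmaFinite (volume : Measure α)] {P : Measure α} [SigmaFinite P] (hP : P ≪ volume) :
    ∀ᵐ x ∂P, dens P x ≠ 0 := by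
  filter_upwards [Measure.rnDeriv_pos hP, hP.ae_le (Measure.rnDeriv_lt_top P volume)] with x h1 h2
  exact (ENNReal.toReal_pos h1.ne' h2.ne).ne'

@[fun_prop]
theorem measurable_dens {α : Type*} [MeasureSpace α] (P : Measure α) : Measurable (dens P) :=
  (Measure.measurable_rnDeriv _ _).ennreal_toReal

/-- Entropy decomposition: the differential entropy of a random vector is the sum of its
copula entropy and of its marginal entropies. -/
theorem entropy_decomposition {d : ℕ} {Ω : Type*} [MeasurableSpace Ω]
    (μ : Measure Ω) [IsProbabilityMeasure μ]
    (z : Ω → Fin d → ℝ) (hz : Measurable z) (hzpdf : μ.map z ≪ volume)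
    (F : Fin d → ℝ → ℝ)
    (hF : ∀ i t, F i t = ((μ.map z).map (fun v => v i) (Set.Iic t)).toReal)
    (hFc : ∀ i, Continuous (F i))
    (hEz : FiniteEnt (μ.map z))
    (hEu : FiniteEnt (μ.map (fun ω i => F i (z ω i))))
    (hEm : ∀ i, FiniteEnt (μ.map (fun ω => z ω i))) :
    diffEnt (μ.map z) = diffEnt (μ.map (fun ω i => F i (z ω i)))
      + ∑ i, diffEnt (μ.map (fun ω => z ω i)) := by
  have hP : IsProbabilityMeasure (μ.map z) := Measure.isProbabilityMeasure_map hz.aemeasurable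
  have hT : Measurable fun (v : Fin d → ℝ) i => F i (v i) := by fun_prop
  have eU : μ.map (fun ω i => F i (z ω i)) = (μ.map z).map fun v i => F i (v i) :=
    (Measure.map_map hT hz).symm
  have eM (i : Fin d) : μ.map (fun ω => z ω i) = (μ.map z).map fun v => v i :=
    (Measure.map_map (measurable_pi_apply i) hz).symm
  simp only [eU, eM] at hEu hEm ⊢
  generalize μ.map z = P at *
  have : IsProbabilityMeasure (P.map fun v i => F i (v i)) :=
    Measure.isProbabilityMeasure_map hT.aemeasurable
  have (i : Fin d) : IsProbabilityMeasure (P.map fun v => v i) :=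
    Measure.isProbabilityMeasure_map (measurable_pi_apply i).aemeasurable
  have hU : P.map (fun v i => F i (v i)) ≪ volume :=
    (copula_absolutelyContinuous P hzpdf hF hFc).trans
      Measure.restrict_le_self.absolutelyContinuous
  have hM := map_eval_absolutelyContinuous P hzpdf
  have hlog : ∀ᵐ x ∂P, Real.log (dens P x)
      = Real.log (dens (P.map fun v i => F i (v i)) (fun i => F i (x i)))
        + ∑ i, Real.log (dens (P.map fun v => v i) (x i)) := by
    filter_upwards [hzpdf.ae_le (dens_ae_eq_copula_mul_prod P hzpdf hF hFc),
      ae_of_ae_map hT.aemeasurable (dens_ae_ne_zero hU),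
      ae_all_iff.2 fun i => ae_of_ae_map (measurable_pi_apply i).aemeasurable
        (dens_ae_ne_zero (hM i))] with x hx hxU hxM
    rw [hx, Real.log_mul hxU (Finset.prod_ne_zero_iff.2 fun i _ => hxM i),
      Real.log_prod fun i _ => hxM i]
  have hiU : Integrable
      (fun x => Real.log (dens (P.map fun v i => F i (v i)) (fun i => F i (x i)))) P :=
    (hEu.integrable_log hU).comp_measurable hT
  have hiM (i : Fin d) : Integrable (fun x => Real.log (dens (P.map fun v => v i) (x i))) P :=
    ((hEm i).integrable_log (hM i)).comp_measurable (measurable_pi_apply i)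
  rw [diffEnt_eq_neg_integral_log hzpdf, diffEnt_eq_neg_integral_log hU,
    Finset.sum_congr rfl fun i _ => diffEnt_eq_neg_integral_log (hM i), integral_congr_ae hlog,
    integral_add hiU (integrable_finsetSum _ fun i _ => hiM i),
    integral_finsetSum _ fun i _ => hiM i, Finset.sum_neg_distrib, neg_add,
    integral_map hT.aemeasurable
      (measurable_dens _).log.aestronglyMeasurable]
  congr 2
  refine Finset.sum_congr rfl fun i _ => ?_
  rw [integral_map (measurable_pi_apply i).aemeasurable
    (measurable_dens _).log.aestronglyMeasurable]
end
end

section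
/- Let x ∈ ℝ^p and y ∈ ℝ^q be random vectors such that (y, x) has a joint pdf with continuous one-dimensional marginal cdfs, and assume all the differential entropies below exist and are finite. Let u_x, u_y and u_{y,x} denote the copula-uniform dual representations of x, y and (y, x) respectively. Then I(y; x) = h(u_y) + h(u_x) − h(u_{y,x}) = I(u_y; u_x). -/
open MeasureTheory Real Set Filter

noncomputable section
open scoped Classical

/-- Kullback-Leibler divergence `KL(P ‖ Q)`, valued in `EReal`. -/
def klDiv {α : Type*} [MeasurableSpace α] (P Q : Measure α) : EReal :=
  if P ≪ Q ∧ Integrable (MeasureTheory.llr P Q) P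
  then ((∫ x, MeasureTheory.llr P Q x ∂P : ℝ) : EReal)
  else ⊤

theorem restrict_rnDeriv_ne_zero_absolutelyContinuous {α : Type*} {m : MeasurableSpace α}
    {P ν : Measure α} [SigmaFinite P] [SigmaFinite ν] (h : P ≪ ν) :
    ν.restrict {a | P.rnDeriv ν a ≠ 0} ≪ P := by
  have hs : MeasurableSet {a | P.rnDeriv ν a ≠ 0} :=
    (Measure.measurable_rnDeriv P ν (measurableSet_singleton 0)).compl
  have hne : ∀ᵐ a ∂ν.restrict {a | P.rnDeriv ν a ≠ 0}, P.rnDeriv ν a ≠ 0 := ae_restrict_mem hs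
  refine (withDensity_absolutelyContinuous' (Measure.measurable_rnDeriv P ν).aemeasurable
    hne).trans ?_
  rw [← restrict_withDensity hs, Measure.withDensity_rnDeriv_eq P ν h]
  exact Measure.absolutelyContinuous_restrict

theorem absolutelyContinuous_restrict_of_ae {α : Type*} {m : MeasurableSpace α}
    {P ν : Measure α} {s : Set α} (h : P ≪ ν) (hs : ∀ᵐ a ∂P, a ∈ s) : P ≪ ν.restrict s := by
  have := h.restrict s
  rwa [Measure.restrict_eq_self_of_ae_mem hs] at this

theorem absolutelyContinuous_prod_marginals {α β : Type*} [MeasurableSpace α] [MeasurableSpace β]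
    {P : Measure (α × β)} [IsProbabilityMeasure P] {ν : Measure α} {κ : Measure β}
    [SigmaFinite ν] [SigmaFinite κ] (h : P ≪ ν.prod κ) (hf : P.map Prod.fst ≪ ν)
    (hs : P.map Prod.snd ≪ κ) : P ≪ (P.map Prod.fst).prod (P.map Prod.snd) := by
  have := Measure.isProbabilityMeasure_map (μ := P) measurable_fst.aemeasurable
  have := Measure.isProbabilityMeasure_map (μ := P) measurable_snd.aemeasurable
  refine (absolutelyContinuous_restrict_of_ae
    (s := {a | (P.map Prod.fst).rnDeriv ν a ≠ 0} ×ˢ {b | (P.map Prod.snd).rnDeriv κ b ≠ 0})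
    h ?_).trans ?_
  · filter_upwards [ae_of_ae_map measurable_fst.aemeasurable (Measure.rnDeriv_pos hf),
      ae_of_ae_map measurable_snd.aemeasurable (Measure.rnDeriv_pos hs)] with a h₁ h₂
    exact ⟨h₁.ne', h₂.ne'⟩
  · rw [← Measure.prod_restrict]
    exact (restrict_rnDeriv_ne_zero_absolutelyContinuous hf).prod
      (restrict_rnDeriv_ne_zero_absolutelyContinuous hs)

theorem absolutelyContinuous_pi {n : ℕ} {α : Fin n → Type*} [∀ i, MeasurableSpace (α i)]
    {ν κ : ∀ i, Measure (α i)} [∀ i, SigmaFinite (ν i)] [∀ i, SigmaFinite (κ i)]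
    (h : ∀ i, ν i ≪ κ i) : Measure.pi ν ≪ Measure.pi κ := by
  induction n with
  | zero => rw [Measure.pi_of_empty, Measure.pi_of_empty]
  | succ n ih =>
    rw [← (measurePreserving_piFinSuccAbove ν 0).symm.map_eq,
      ← (measurePreserving_piFinSuccAbove κ 0).symm.map_eq]
    exact ((h 0).prod (ih fun i => h _)).map (MeasurableEquiv.measurable _)

theorem absolutelyContinuous_pi_marginals {n : ℕ} {P : Measure (Fin n → ℝ)}
    [IsProbabilityMeasure P] (h : P ≪ volume) :
    P ≪ Measure.pi fun i => P.map fun v => v i := by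
  have hprob (i : Fin n) : IsProbabilityMeasure (P.map fun v => v i) :=
    Measure.isProbabilityMeasure_map (measurable_pi_apply i).aemeasurable
  have hi (i : Fin n) : P.map (fun v => v i) ≪ volume :=
    (h.map (measurable_pi_apply i)).trans
      (Measure.quasiMeasurePreserving_eval (fun _ => volume) i).absolutelyContinuous
  refine (absolutelyContinuous_restrict_of_ae (s := Set.univ.pi fun i =>
    {a | (P.map fun v => v i).rnDeriv volume a ≠ 0}) h ?_).trans ?_
  · have (i : Fin n) : ∀ᵐ v ∂P, (P.map fun v => v i).rnDeriv volume (v i) ≠ 0 := by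
      filter_upwards [ae_of_ae_map (measurable_pi_apply i).aemeasurable
        (Measure.rnDeriv_pos (hi i))] with v hv using hv.ne'
    filter_upwards [ae_all_iff.2 this] with v hv i _ using hv i
  · rw [volume_pi, Measure.restrict_pi_pi]
    exact absolutelyContinuous_pi fun i => restrict_rnDeriv_ne_zero_absolutelyContinuous (hi i)

/-- The probability integral transform: a continuous cdf pushes its law to the uniform law. -/
theorem map_cdf_eq_unif01 {P : Measure ℝ} [IsProbabilityMeasure P] {F : ℝ → ℝ}
    (hF : ∀ t, F t = (P (Set.Iic t)).toReal) (hc : Continuous F) : P.map F = unif01 := by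
  have hF' : F = ProbabilityTheory.cdf P := by
    ext t
    rw [hF, ProbabilityTheory.cdf_eq_real, measureReal_def]
  have hm : Monotone F := hF' ▸ ProbabilityTheory.monotone_cdf P
  have h0 : ∀ t, 0 ≤ F t := hF' ▸ ProbabilityTheory.cdf_nonneg P
  have h1 : ∀ t, F t ≤ 1 := hF' ▸ ProbabilityTheory.cdf_le_one P
  have hbot : Tendsto F atBot (nhds 0) := hF' ▸ ProbabilityTheory.tendsto_cdf_atBot P
  have htop : Tendsto F atTop (nhds 1) := hF' ▸ ProbabilityTheory.tendsto_cdf_atTop P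
  have hP (t : ℝ) : P (Set.Iic t) = ENNReal.ofReal (F t) := by
    rw [hF, ENNReal.ofReal_toReal (measure_ne_top _ _)]
  have hsurj {a : ℝ} (ha : 0 < a) (ha' : a < 1) : ∃ t, F t = a := by
    obtain ⟨s, hs⟩ := (hbot.eventually (gt_mem_nhds ha)).exists
    obtain ⟨t, ht⟩ := (htop.eventually (lt_mem_nhds ha')).exists
    exact mem_range_of_exists_le_of_exists_ge hc ⟨s, hs.le⟩ ⟨t, ht.le⟩
  have := Measure.isProbabilityMeasure_map (μ := P) hc.measurable.aemeasurable
  refine Measure.ext_of_Iic _ _ fun a => ?_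
  rw [Measure.map_apply hc.measurable measurableSet_Iic, unif01,
    Measure.restrict_apply measurableSet_Iic]
  rcases lt_or_ge a 0 with ha | ha
  · have e₁ : F ⁻¹' Set.Iic a = ∅ := by
      ext t
      simpa using ha.trans_le (h0 t)
    have e₂ : Set.Iic a ∩ Set.Icc (0 : ℝ) 1 = ∅ := by
      ext t
      simp only [Set.mem_inter_iff, Set.mem_Iic, Set.mem_Icc, Set.mem_empty_iff_false, iff_false]
      intro h
      linarith
    simp [e₁, e₂]
  rcases lt_or_ge a 1 with ha' | ha'
  · have e₂ : Set.Iic a ∩ Set.Icc (0 : ℝ) 1 = Set.Icc 0 a := by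
      ext t
      simp only [Set.mem_inter_iff, Set.mem_Iic, Set.mem_Icc]
      constructor
      · intro h
        exact ⟨h.2.1, h.1⟩
      · intro h
        exact ⟨h.2, h.1, h.2.trans ha'.le⟩
    rw [e₂, Real.volume_Icc, sub_zero]
    apply le_antisymm
    · have hb : ∀ b ∈ Set.Ioo a 1, P (F ⁻¹' Set.Iic a) ≤ ENNReal.ofReal b := by
        rintro b ⟨hab, hb1⟩
        obtain ⟨s, hs⟩ := hsurj (ha.trans_lt hab) hb1
        rw [← hs, ← hP]
        refine measure_mono fun t ht => ?_
        by_contra hts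
        have := hm (not_le.1 hts).le
        rw [hs] at this
        exact absurd (this.trans ht) (not_le.2 hab)
      have hlim : Tendsto ENNReal.ofReal (nhdsWithin a (Set.Ioi a)) (nhds (ENNReal.ofReal a)) :=
        (ENNReal.continuous_ofReal.tendsto a).mono_left nhdsWithin_le_nhds
      exact ge_of_tendsto hlim (Filter.mem_of_superset (Ioo_mem_nhdsGT ha') hb)
    · rcases ha.eq_or_lt with rfl | ha0
      · simp
      · obtain ⟨t, ht⟩ := hsurj ha0 ha'
        conv_lhs => rw [← ht]
        rw [← hP]
        exact measure_mono fun s hs => (hm hs).trans ht.le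
  · have e₁ : F ⁻¹' Set.Iic a = Set.univ := by
      ext t
      simpa using (h1 t).trans ha'
    have e₂ : Set.Iic a ∩ Set.Icc (0 : ℝ) 1 = Set.Icc 0 1 := by
      ext t
      simp only [Set.mem_inter_iff, Set.mem_Iic, Set.mem_Icc, and_iff_right_iff_imp]
      intro h
      exact h.2.trans ha'
    simp [e₁, e₂]

/-- A continuous cdf is injective on a measurable set of full measure. -/
theorem exists_injOn_cdf {P : Measure ℝ} [IsProbabilityMeasure P] {F : ℝ → ℝ}
    (hF : ∀ t, F t = (P (Set.Iic t)).toReal) (hc : Continuous F) :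
    ∃ S : Set ℝ, MeasurableSet S ∧ (∀ᵐ t ∂P, t ∈ S) ∧ Set.InjOn F S := by
  have hm : Monotone F := fun s t hst => by
    rw [hF, hF]
    exact ENNReal.toReal_mono (measure_ne_top _ _) (measure_mono (Set.Iic_subset_Iic.2 hst))
  have hmem (r : ℚ) : MeasurableSet {t | F t ≠ F r} :=
    (hc.measurable (measurableSet_singleton (F r))).compl
  refine ⟨⋂ r : ℚ, {t | F t ≠ F r}, MeasurableSet.iInter hmem, ?_, ?_⟩
  · simp only [Set.mem_iInter]
    refine ae_all_iff.2 fun r => ?_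
    have h : P.map F {F r} = 0 := by
      rw [map_cdf_eq_unif01 hF hc]
      exact Measure.absolutelyContinuous_restrict (measure_singleton _)
    rw [Measure.map_apply hc.measurable (measurableSet_singleton _)] at h
    rw [ae_iff]
    simpa [Set.preimage] using h
  · have key : ∀ s t, t ∈ ⋂ r : ℚ, {t | F t ≠ F r} → s < t → F s ≠ F t := by
      intro s t ht hst he
      obtain ⟨r, hr, hr'⟩ := exists_rat_btwn hst
      exact Set.mem_iInter.1 ht r (le_antisymm (he ▸ hm hr.le) (hm hr'.le))
    intro s hs t ht he
    by_contra hne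
    rcases lt_or_gt_of_ne hne with h | h
    · exact key s t ht h he
    · exact key t s hs h he.symm

theorem preimage_image_inter_ae_eq {α β : Type*} [MeasurableSpace α] {P : Measure α} {T : α → β}
    {S : Set α} (hinj : Set.InjOn T S) (hP : ∀ᵐ a ∂P, a ∈ S) (A : Set α) :
    T ⁻¹' (T '' (A ∩ S)) =ᵐ[P] A := by
  filter_upwards [hP] with a ha
  refine propext ⟨?_, fun h => ⟨a, ⟨h, ha⟩, rfl⟩⟩
  rintro ⟨b, ⟨hb, hbS⟩, he⟩
  exact hinj hbS ha he ▸ hb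

/-- The Kullback-Leibler divergence is invariant under measurable maps that are injective on a
set of full measure. -/
theorem klDiv_map_of_injOn {α β : Type*} [MeasurableSpace α] [StandardBorelSpace α]
    [MeasurableSpace β] [MeasurableSpace.CountablySeparated β] {P Q : Measure α}
    [IsProbabilityMeasure P] [IsProbabilityMeasure Q] {T : α → β}
    (hT : Measurable T) {S : Set α} (hS : MeasurableSet S) (hinj : Set.InjOn T S)
    (hP : ∀ᵐ a ∂P, a ∈ S) (hQ : ∀ᵐ a ∂Q, a ∈ S) :
    klDiv P Q = klDiv (P.map T) (Q.map T) := by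
  have := Measure.isProbabilityMeasure_map (μ := P) hT.aemeasurable
  have := Measure.isProbabilityMeasure_map (μ := Q) hT.aemeasurable
  have him {A : Set α} (hA : MeasurableSet A) : MeasurableSet (T '' (A ∩ S)) :=
    (hA.inter hS).image_of_measurable_injOn hT (hinj.mono Set.inter_subset_right)
  have hPA {A : Set α} (hA : MeasurableSet A) : P A = P.map T (T '' (A ∩ S)) := by
    rw [Measure.map_apply hT (him hA)]
    exact measure_congr (preimage_image_inter_ae_eq hinj hP A).symm
  have hQA {A : Set α} (hA : MeasurableSet A) : Q A = Q.map T (T '' (A ∩ S)) := by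
    rw [Measure.map_apply hT (him hA)]
    exact measure_congr (preimage_image_inter_ae_eq hinj hQ A).symm
  have hac : P ≪ Q ↔ P.map T ≪ Q.map T := by
    refine ⟨fun h => h.map hT, fun h => Measure.AbsolutelyContinuous.mk fun A hA h0 => ?_⟩
    rw [hPA hA]
    exact h (hQA hA ▸ h0)
  by_cases h : P ≪ Q
  · have h' := hac.1 h
    have hdens : P = Q.withDensity fun a => (P.map T).rnDeriv (Q.map T) (T a) := by
      ext A hA
      rw [hPA hA, ← Measure.setLIntegral_rnDeriv h', withDensity_apply _ hA,
        setLIntegral_map (him hA) (Measure.measurable_rnDeriv _ _) hT]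
      exact setLIntegral_congr (preimage_image_inter_ae_eq hinj hQ A)
    have hrn : (fun a => (P.map T).rnDeriv (Q.map T) (T a)) =ᵐ[Q] P.rnDeriv Q := by
      have hrn' := Measure.rnDeriv_withDensity Q
        ((Measure.measurable_rnDeriv (P.map T) (Q.map T)).comp hT)
      exact hrn'.symm.trans (congrArg (fun R : Measure α => R.rnDeriv Q) hdens.symm).eventuallyEq
    have hllr : llr P Q =ᵐ[P] fun a => llr (P.map T) (Q.map T) (T a) := by
      filter_upwards [h.ae_le hrn] with a ha
      simp only [llr, ha]
    have hsm : AEStronglyMeasurable (llr (P.map T) (Q.map T)) (P.map T) :=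
      (measurable_llr _ _).aestronglyMeasurable
    have hint : Integrable (llr P Q) P ↔ Integrable (llr (P.map T) (Q.map T)) (P.map T) := by
      rw [integrable_congr hllr, integrable_map_measure hsm hT.aemeasurable]
      rfl
    unfold klDiv
    rw [integral_congr_ae hllr, ← integral_map hT.aemeasurable hsm]
    simp only [hac, hint]
  · unfold klDiv
    rw [if_neg fun h' => h h'.1, if_neg fun h' => h (hac.2 h'.1)]

theorem finiteEnt_iff_integrable_llr {α : Type*} [MeasureSpace α]
    [SigmaFinite (volume : Measure α)] {P : Measure α} [SigmaFinite P] (h : P ≪ volume) :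
    FiniteEnt P ↔ Integrable (llr P volume) P :=
  integrable_rnDeriv_mul_log_iff h

theorem diffEnt_eq_neg_integral_llr {α : Type*} [MeasureSpace α]
    [SigmaFinite (volume : Measure α)] {P : Measure α} [SigmaFinite P] (h : P ≪ volume) :
    diffEnt P = -∫ a, llr P volume a ∂P :=
  congrArg Neg.neg (integral_rnDeriv_mul_log h)

theorem dens_map_measurableEquiv {α β : Type*} [MeasureSpace α] [MeasureSpace β]
    [SigmaFinite (volume : Measure α)] (e : α ≃ᵐ β) (he : MeasurePreserving e)
    (P : Measure α) [SigmaFinite P] : (fun a => dens (P.map e) (e a)) =ᵐ[volume] dens P := by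
  filter_upwards [e.measurableEmbedding.rnDeriv_map P volume] with a ha
  rw [he.map_eq] at ha
  simp only [dens, ha]

theorem finiteEnt_map_measurableEquiv {α β : Type*} [MeasureSpace α] [MeasureSpace β]
    [SigmaFinite (volume : Measure α)] (e : α ≃ᵐ β) (he : MeasurePreserving e)
    (P : Measure α) [SigmaFinite P] : FiniteEnt (P.map e) ↔ FiniteEnt P := by
  unfold FiniteEnt
  rw [← he.integrable_comp_emb e.measurableEmbedding]
  refine integrable_congr ?_
  filter_upwards [dens_map_measurableEquiv e he P] with a ha
  simp only [Function.comp_apply, ha]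

theorem diffEnt_map_measurableEquiv {α β : Type*} [MeasureSpace α] [MeasureSpace β]
    [SigmaFinite (volume : Measure α)] (e : α ≃ᵐ β) (he : MeasurePreserving e)
    (P : Measure α) [SigmaFinite P] : diffEnt (P.map e) = diffEnt P := by
  unfold diffEnt
  rw [← he.integral_comp e.measurableEmbedding]
  congr 1
  refine integral_congr_ae ?_
  filter_upwards [dens_map_measurableEquiv e he P] with a ha
  simp only [ha]

theorem rnDeriv_prod_ae_eq {α β : Type*} [MeasurableSpace α] [MeasurableSpace β]
    {P ν : Measure α} {Q κ : Measure β} [SigmaFinite P] [SigmaFinite Q] [SigmaFinite ν]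
    [SigmaFinite κ] (hP : P ≪ ν) (hQ : Q ≪ κ) :
    (P.prod Q).rnDeriv (ν.prod κ) =ᵐ[ν.prod κ] fun z => P.rnDeriv ν z.1 * Q.rnDeriv κ z.2 := by
  have h : P.prod Q = (ν.prod κ).withDensity fun z => P.rnDeriv ν z.1 * Q.rnDeriv κ z.2 := by
    rw [← prod_withDensity (Measure.measurable_rnDeriv P ν) (Measure.measurable_rnDeriv Q κ),
      Measure.withDensity_rnDeriv_eq P ν hP, Measure.withDensity_rnDeriv_eq Q κ hQ]
  rw [h]
  exact Measure.rnDeriv_withDensity _ (by fun_prop)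

/-- The mutual information is the sum of the marginal entropies minus the joint entropy. -/
theorem klDiv_prod_marginals_eq_diffEnt {α β : Type*} [MeasureSpace α] [MeasureSpace β]
    [SigmaFinite (volume : Measure α)] [SigmaFinite (volume : Measure β)]
    {P : Measure (α × β)} [IsProbabilityMeasure P] (h : P ≪ volume) (hP : FiniteEnt P)
    (hf : FiniteEnt (P.map Prod.fst)) (hs : FiniteEnt (P.map Prod.snd)) :
    klDiv P ((P.map Prod.fst).prod (P.map Prod.snd))
      = ((diffEnt (P.map Prod.fst) + diffEnt (P.map Prod.snd) - diffEnt P : ℝ) : EReal) := by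
  have := Measure.isProbabilityMeasure_map (μ := P) measurable_fst.aemeasurable
  have := Measure.isProbabilityMeasure_map (μ := P) measurable_snd.aemeasurable
  have hσ : SigmaFinite (volume : Measure (α × β)) := by
    rw [Measure.volume_eq_prod]
    infer_instance
  have h₁ : P.map Prod.fst ≪ volume :=
    (h.map measurable_fst).trans Measure.quasiMeasurePreserving_fst.absolutelyContinuous
  have h₂ : P.map Prod.snd ≪ volume :=
    (h.map measurable_snd).trans Measure.quasiMeasurePreserving_snd.absolutelyContinuous
  have hac := absolutelyContinuous_prod_marginals (ν := volume) (κ := volume) h h₁ h₂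
  rw [finiteEnt_iff_integrable_llr h] at hP
  rw [finiteEnt_iff_integrable_llr h₁,
    integrable_map_measure (measurable_llr _ _).aestronglyMeasurable
      measurable_fst.aemeasurable] at hf
  rw [finiteEnt_iff_integrable_llr h₂,
    integrable_map_measure (measurable_llr _ _).aestronglyMeasurable
      measurable_snd.aemeasurable] at hs
  have hllr : llr P ((P.map Prod.fst).prod (P.map Prod.snd)) =ᵐ[P]
      fun z => llr P volume z - llr (P.map Prod.fst) volume z.1
        - llr (P.map Prod.snd) volume z.2 := by
    filter_upwards [h.ae_le (Measure.rnDeriv_mul_rnDeriv (κ := volume) hac),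
      h.ae_le (rnDeriv_prod_ae_eq h₁ h₂), Measure.rnDeriv_pos hac,
      hac.ae_le (Measure.rnDeriv_ne_top P ((P.map Prod.fst).prod (P.map Prod.snd))),
      ae_of_ae_map measurable_fst.aemeasurable (Measure.rnDeriv_pos h₁),
      ae_of_ae_map measurable_snd.aemeasurable (Measure.rnDeriv_pos h₂),
      ae_of_ae_map measurable_fst.aemeasurable
        (h₁.ae_le (Measure.rnDeriv_ne_top (P.map Prod.fst) volume)),
      ae_of_ae_map measurable_snd.aemeasurable
        (h₂.ae_le (Measure.rnDeriv_ne_top (P.map Prod.snd) volume))]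
      with z hz hprod h0 htop hf0 hs0 hft hst
    rw [← Measure.volume_eq_prod] at hprod
    simp only [llr]
    rw [← hz, Pi.mul_apply, hprod, ENNReal.toReal_mul, ENNReal.toReal_mul,
      Real.log_mul (ENNReal.toReal_pos h0.ne' htop).ne'
        (mul_pos (ENNReal.toReal_pos hf0.ne' hft) (ENNReal.toReal_pos hs0.ne' hst)).ne',
      Real.log_mul (ENNReal.toReal_pos hf0.ne' hft).ne' (ENNReal.toReal_pos hs0.ne' hst).ne']
    ring
  have hint : Integrable (fun z : α × β => llr P volume z - llr (P.map Prod.fst) volume z.1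
      - llr (P.map Prod.snd) volume z.2) P := (hP.sub hf).sub hs
  rw [klDiv, if_pos ⟨hac, (integrable_congr hllr).2 hint⟩, EReal.coe_eq_coe_iff,
    integral_congr_ae hllr, diffEnt_eq_neg_integral_llr h, diffEnt_eq_neg_integral_llr h₁,
    diffEnt_eq_neg_integral_llr h₂,
    integral_map measurable_fst.aemeasurable (measurable_llr _ _).aestronglyMeasurable,
    integral_map measurable_snd.aemeasurable (measurable_llr _ _).aestronglyMeasurable]
  have e₁ := integral_sub (hP.sub hf) hs
  have e₂ := integral_sub hP hf
  simp only [Function.comp_apply, Pi.sub_apply] at e₁ e₂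
  rw [e₁, e₂]
  ring

/-- `Fin.append` as a measurable equivalence. -/
def finAppendMeasurableEquiv (m n : ℕ) :
    ((Fin m → ℝ) × (Fin n → ℝ)) ≃ᵐ (Fin (m + n) → ℝ) :=
  (Fin.appendHomeomorph m n).toMeasurableEquiv

theorem finAppendMeasurableEquiv_apply {m n : ℕ} (z : (Fin m → ℝ) × (Fin n → ℝ)) :
    finAppendMeasurableEquiv m n z = Fin.append z.1 z.2 :=
  rfl

theorem measurePreserving_finAppend (m n : ℕ) :
    MeasurePreserving (finAppendMeasurableEquiv m n) := by
  refine ⟨(finAppendMeasurableEquiv m n).measurable, (Measure.pi_eq fun s hs => ?_).symm⟩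
  have hpre : finAppendMeasurableEquiv m n ⁻¹' Set.univ.pi s
      = (Set.univ.pi fun i => s (Fin.castAdd n i)) ×ˢ
        (Set.univ.pi fun j => s (Fin.natAdd m j)) := by
    ext z
    simp [finAppendMeasurableEquiv_apply, Fin.forall_fin_add]
  rw [MeasurableEquiv.map_apply, hpre, Measure.volume_eq_prod, Measure.prod_prod, volume_pi_pi,
    volume_pi_pi, Fin.prod_univ_add]

/-- The copula-uniform dual representation of an absolutely continuous law is absolutely
continuous. -/
theorem map_pi_cdf_absolutelyContinuous {n : ℕ} {P : Measure (Fin n → ℝ)}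
    [IsProbabilityMeasure P] (h : P ≪ volume) {F : Fin n → ℝ → ℝ}
    (hF : ∀ i t, F i t = (P.map (fun v => v i) (Set.Iic t)).toReal)
    (hc : ∀ i, Continuous (F i)) : P.map (fun v i => F i (v i)) ≪ volume := by
  have hprob (i : Fin n) : IsProbabilityMeasure (P.map fun v => v i) :=
    Measure.isProbabilityMeasure_map (measurable_pi_apply i).aemeasurable
  have hprob' (i : Fin n) : IsProbabilityMeasure ((P.map fun v => v i).map (F i)) :=
    Measure.isProbabilityMeasure_map (hc i).measurable.aemeasurable
  have hmeas : Measurable fun (v : Fin n → ℝ) i => F i (v i) :=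
    measurable_pi_lambda _ fun i => (hc i).measurable.comp (measurable_pi_apply i)
  refine ((absolutelyContinuous_pi_marginals h).map hmeas).trans ?_
  rw [Measure.pi_map_pi fun i => (hc i).measurable.aemeasurable, volume_pi]
  refine absolutelyContinuous_pi fun i => ?_
  rw [map_cdf_eq_unif01 (hF i) (hc i)]
  exact Measure.absolutelyContinuous_restrict

/-- The mutual information equals the sum of the individual copula entropies minus the joint
copula entropy, and equals the mutual information of the copula-uniform dual representations. -/
theorem mutual_information_copula {p q : ℕ} {Ω : Type*} [MeasurableSpace Ω]
    (μ : Measure Ω) [IsProbabilityMeasure μ]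
    (y : Ω → Fin q → ℝ) (x : Ω → Fin p → ℝ) (hy : Measurable y) (hx : Measurable x)
    (hpdf : μ.map (fun ω => Fin.append (y ω) (x ω)) ≪ volume)
    (F : Fin (q + p) → ℝ → ℝ)
    (hF : ∀ i t, F i t
      = ((μ.map (fun ω => Fin.append (y ω) (x ω))).map (fun v => v i) (Set.Iic t)).toReal)
    (hFc : ∀ i, Continuous (F i))
    (uy : Ω → Fin q → ℝ) (huy : ∀ ω j, uy ω j = F (Fin.castAdd p j) (y ω j))
    (ux : Ω → Fin p → ℝ) (hux : ∀ ω i, ux ω i = F (Fin.natAdd q i) (x ω i))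
    (uyx : Ω → Fin (q + p) → ℝ) (huyx : ∀ ω i, uyx ω i = F i (Fin.append (y ω) (x ω) i))
    (hEy : FiniteEnt (μ.map uy)) (hEx : FiniteEnt (μ.map ux))
    (hEyx : FiniteEnt (μ.map uyx)) :
    klDiv (μ.map fun ω => (y ω, x ω)) ((μ.map y).prod (μ.map x))
      = ((diffEnt (μ.map uy) + diffEnt (μ.map ux) - diffEnt (μ.map uyx) : ℝ) : EReal) ∧
    klDiv (μ.map fun ω => (y ω, x ω)) ((μ.map y).prod (μ.map x))
      = klDiv (μ.map fun ω => (uy ω, ux ω)) ((μ.map uy).prod (μ.map ux)) := by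
  have hFm (i : Fin (q + p)) : Measurable (F i) := (hFc i).measurable
  have happ : Measurable fun ω => Fin.append (y ω) (x ω) :=
    (finAppendMeasurableEquiv q p).measurable.comp (hy.prodMk hx)
  have hev (i : Fin (q + p)) : Measurable fun v : Fin (q + p) → ℝ => v i := measurable_pi_apply i
  have hprobz := Measure.isProbabilityMeasure_map (μ := μ) happ.aemeasurable
  have hprobi (i : Fin (q + p)) :=
    Measure.isProbabilityMeasure_map (μ := μ.map fun ω => Fin.append (y ω) (x ω))
      (hev i).aemeasurable
  have := Measure.isProbabilityMeasure_map (μ := μ) hy.aemeasurable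
  have := Measure.isProbabilityMeasure_map (μ := μ) hx.aemeasurable
  have := Measure.isProbabilityMeasure_map (μ := μ) (hy.prodMk hx).aemeasurable
  set Ty : (Fin q → ℝ) → Fin q → ℝ := fun v j => F (Fin.castAdd p j) (v j)
  set Tx : (Fin p → ℝ) → Fin p → ℝ := fun v i => F (Fin.natAdd q i) (v i)
  have hTym : Measurable Ty :=
    measurable_pi_lambda _ fun j => (hFm _).comp (measurable_pi_apply j)
  have hTxm : Measurable Tx :=
    measurable_pi_lambda _ fun i => (hFm _).comp (measurable_pi_apply i)
  obtain rfl : uy = fun ω => Ty (y ω) := by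
    ext ω j
    exact huy ω j
  obtain rfl : ux = fun ω => Tx (x ω) := by
    ext ω i
    exact hux ω i
  obtain rfl : uyx = fun ω i => F i (Fin.append (y ω) (x ω) i) := by
    ext ω i
    exact huyx ω i
  have huym : Measurable fun ω => Ty (y ω) := hTym.comp hy
  have huxm : Measurable fun ω => Tx (x ω) := hTxm.comp hx
  have hdual : (fun ω i => F i (Fin.append (y ω) (x ω) i))
      = fun ω => finAppendMeasurableEquiv q p (Ty (y ω), Tx (x ω)) := by
    ext ω i
    rw [finAppendMeasurableEquiv_apply]
    refine Fin.addCases (fun j => ?_) (fun j => ?_) i <;> simp [Ty, Tx]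
  set R := μ.map fun ω => (Ty (y ω), Tx (x ω)) with hR
  have hRprob : IsProbabilityMeasure R :=
    Measure.isProbabilityMeasure_map (huym.prodMk huxm).aemeasurable
  have hRfst : R.map Prod.fst = μ.map fun ω => Ty (y ω) :=
    Measure.map_map measurable_fst (huym.prodMk huxm)
  have hRsnd : R.map Prod.snd = μ.map fun ω => Tx (x ω) :=
    Measure.map_map measurable_snd (huym.prodMk huxm)
  have hRe : (μ.map fun ω i => F i (Fin.append (y ω) (x ω) i))
      = R.map (finAppendMeasurableEquiv q p) := by
    rw [hdual, hR, Measure.map_map (MeasurableEquiv.measurable _) (huym.prodMk huxm)]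
    rfl
  have hRac : R ≪ volume := by
    have hac := map_pi_cdf_absolutelyContinuous hpdf hF hFc
    have hm : Measurable fun (v : Fin (q + p) → ℝ) i => F i (v i) :=
      measurable_pi_lambda _ fun i => (hFm i).comp (hev i)
    rw [Measure.map_map hm happ] at hac
    have hac' : R.map (finAppendMeasurableEquiv q p) ≪ volume := hRe ▸ hac
    have := hac'.map (finAppendMeasurableEquiv q p).symm.measurable
    rwa [MeasurableEquiv.map_symm_map, ((measurePreserving_finAppend q p).symm _).map_eq] at this
  choose S hSm hSae hSinj using fun i => exists_injOn_cdf (hF i) (hFc i)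
  have hSae' (i : Fin (q + p)) : ∀ᵐ ω ∂μ, Fin.append (y ω) (x ω) i ∈ S i :=
    ae_of_ae_map happ.aemeasurable (ae_of_ae_map (hev i).aemeasurable (hSae i))
  set Sy : Set (Fin q → ℝ) := Set.univ.pi fun j => S (Fin.castAdd p j)
  set Sx : Set (Fin p → ℝ) := Set.univ.pi fun i => S (Fin.natAdd q i)
  have hSym : MeasurableSet Sy := MeasurableSet.univ_pi fun j => hSm _
  have hSxm : MeasurableSet Sx := MeasurableSet.univ_pi fun i => hSm _
  have hySy : ∀ᵐ ω ∂μ, y ω ∈ Sy := by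
    filter_upwards [ae_all_iff.2 hSae'] with ω h j _
    simpa using h (Fin.castAdd p j)
  have hxSx : ∀ᵐ ω ∂μ, x ω ∈ Sx := by
    filter_upwards [ae_all_iff.2 hSae'] with ω h i _
    simpa using h (Fin.natAdd q i)
  have hinj : Set.InjOn (Prod.map Ty Tx) (Sy ×ˢ Sx) := by
    rintro ⟨a, b⟩ ⟨ha, hb⟩ ⟨a', b'⟩ ⟨ha', hb'⟩ he
    rw [Prod.map_apply, Prod.map_apply, Prod.mk.injEq] at he
    refine Prod.ext (funext fun j => ?_) (funext fun i => ?_)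
    · exact hSinj _ (ha j trivial) (ha' j trivial) (congrFun he.1 j)
    · exact hSinj _ (hb i trivial) (hb' i trivial) (congrFun he.2 i)
  have hP : ∀ᵐ z ∂μ.map fun ω => (y ω, x ω), z ∈ Sy ×ˢ Sx := by
    refine (ae_map_iff (hy.prodMk hx).aemeasurable (hSym.prod hSxm)).2 ?_
    filter_upwards [hySy, hxSx] with ω h₁ h₂ using ⟨h₁, h₂⟩
  have hQ : ∀ᵐ z ∂(μ.map y).prod (μ.map x), z ∈ Sy ×ˢ Sx := by
    filter_upwards [Measure.quasiMeasurePreserving_fst.ae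
        ((ae_map_iff hy.aemeasurable hSym).2 hySy),
      Measure.quasiMeasurePreserving_snd.ae
        ((ae_map_iff hx.aemeasurable hSxm).2 hxSx)] with z h₁ h₂ using ⟨h₁, h₂⟩
  have hkl : klDiv (μ.map fun ω => (y ω, x ω)) ((μ.map y).prod (μ.map x))
      = klDiv R ((μ.map fun ω => Ty (y ω)).prod (μ.map fun ω => Tx (x ω))) := by
    rw [klDiv_map_of_injOn (hTym.prodMap hTxm) (hSym.prod hSxm) hinj hP hQ,
      ← Measure.map_prod_map _ _ hTym hTxm, Measure.map_map hTym hy, Measure.map_map hTxm hx,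
      Measure.map_map (hTym.prodMap hTxm) (hy.prodMk hx)]
    rfl
  refine ⟨?_, hkl⟩
  rw [hRe, finiteEnt_map_measurableEquiv _ (measurePreserving_finAppend q p)] at hEyx
  rw [hkl, hRe, diffEnt_map_measurableEquiv _ (measurePreserving_finAppend q p), ← hRfst, ← hRsnd]
  exact klDiv_prod_marginals_eq_diffEnt hRac hEyx (hRfst ▸ hEy) (hRsnd ▸ hEx)
end
end
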